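/- arXiv:2008.07938 — 3 statements merged into one kernel-verified Lean document; each statement's English description precedes it below -/
import Mathlib

section
/- For every (x,y) in the open triangle Δ, writing u = 1−x+y and E_k = 2−x+ku, the series Σ_{k=0}^∞ (1/E_k^3) · h((ku+1−y)/E_k, (x−y)/E_k) converges and equals h(x,y), where h(u',v') = 1/((u'−2)(1−u'+v')). That is, h(x,y) = 1/((x−2)(1−x+y)) is an eigenfunction of eigenvalue 1 of the transfer operator of the triangle partition map T_{132,123,123}. -/
/-- For an arithmetic progression of positive reals with positive step `u`, the reciprocals of
the products of consecutive terms sum to `1 / (a * u)`. -/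
theorem hasSum_one_div_mul_succ_arith {a u : ℝ} (ha : 0 < a) (hu : 0 < u) :
    HasSum (fun k : ℕ => 1 / ((a + k * u) * (a + (k + 1) * u))) (1 / (a * u)) := by
  have hpos : ∀ k : ℕ, 0 < a + k * u := fun k => by positivity
  rw [hasSum_iff_tendsto_nat_of_nonneg (fun k => by positivity)]
  have hsum : ∀ n : ℕ, ∑ k ∈ Finset.range n, 1 / ((a + k * u) * (a + (k + 1) * u)) =
      1 / (a * u) - (a + n * u)⁻¹ / u := by
    intro n
    induction n with
    | zero => simp [div_eq_mul_inv, mul_comm]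
    | succ n ih =>
      have h₁ := (hpos n).ne'
      have h₂ : a + (n + 1) * u ≠ 0 := by positivity
      rw [Finset.sum_range_succ, ih]
      push_cast
      field_simp
      ring
  simp_rw [hsum]
  have hlim : Filter.Tendsto (fun n : ℕ => a + n * u) Filter.atTop Filter.atTop :=
    Filter.tendsto_atTop_add_const_left _ _
      (tendsto_natCast_atTop_atTop.atTop_mul_const hu)
  simpa using (hlim.inv_tendsto_atTop.div_const u).const_sub (1 / (a * u))

/-- The function `h(x,y) = 1/((x−2)(1−x+y))` is an eigenfunction of eigenvalue 1 of the
transfer operator of the triangle partition map `T_{132,123,123}`: for every `(x,y)` in the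
open triangle `Δ = {0 < y < x < 1}`, writing `u = 1−x+y` and `E_k = 2−x+ku`, the series
`Σ_k (1/E_k^3) · h((ku+1−y)/E_k, (x−y)/E_k)` converges and equals `h(x,y)`,
where `h(u',v') = 1/((u'−2)(1−u'+v'))`. -/
theorem trip_132123123_eigenfunction (x y : ℝ) (hy : 0 < y) (hyx : y < x) (hx : x < 1) :
    HasSum (fun k : ℕ =>
      (1 / (2 - x + (k : ℝ) * (1 - x + y)) ^ 3) *
        (1 / (((((k : ℝ) * (1 - x + y) + 1 - y) / (2 - x + (k : ℝ) * (1 - x + y))) - 2) *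
          (1 - ((k : ℝ) * (1 - x + y) + 1 - y) / (2 - x + (k : ℝ) * (1 - x + y)) +
            (x - y) / (2 - x + (k : ℝ) * (1 - x + y))))))
      (1 / ((x - 2) * (1 - x + y))) := by
  have hu : 0 < 1 - x + y := by linarith
  have ha : 0 < 2 - x := by linarith
  rw [← neg_sub 2 x, neg_mul, one_div_neg_eq_neg_one_div]
  refine (congrArg (HasSum · _) (funext fun k => ?_)).mpr
    (hasSum_one_div_mul_succ_arith ha hu).neg
  have hE : 0 < 2 - x + (k : ℝ) * (1 - x + y) := by positivity
  have hE' : 0 < 2 - x + ((k : ℝ) + 1) * (1 - x + y) := by positivity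
  have h₁ : ((k : ℝ) * (1 - x + y) + 1 - y) / (2 - x + (k : ℝ) * (1 - x + y)) - 2 =
      -((2 - x + ((k : ℝ) + 1) * (1 - x + y)) / (2 - x + (k : ℝ) * (1 - x + y))) := by
    rw [eq_neg_iff_add_eq_zero]
    field_simp
    ring
  have h₂ : 1 - ((k : ℝ) * (1 - x + y) + 1 - y) / (2 - x + (k : ℝ) * (1 - x + y)) +
      (x - y) / (2 - x + (k : ℝ) * (1 - x + y)) = 1 / (2 - x + (k : ℝ) * (1 - x + y)) := by
    field_simp
    ring
  rw [h₁, h₂]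
  generalize 2 - x + (k : ℝ) * (1 - x + y) = E at *
  generalize 2 - x + ((k : ℝ) + 1) * (1 - x + y) = E' at *
  field_simp
end

section
/- Let f : Δ → ℝ be continuous and let M ≥ 0 satisfy |x·f(x,y)| ≤ M for all (x,y) ∈ Δ. Then: (i) for every (x,y) ∈ Δ and k ∈ ℕ, the point (1/((k+1)x−y+1), (1−x)/((k+1)x−y+1)) lies in Δ; (ii) for every (x,y) ∈ Δ the series (Lf)(x,y) = Σ_{k=0}^∞ (1/((k+1)x−y+1)^3) f(1/((k+1)x−y+1), (1−x)/((k+1)x−y+1)) converges absolutely; (iii) the function Lf is continuous on Δ; and (iv) |x·(Lf)(x,y)| ≤ 2M for all (x,y) ∈ Δ. In particular the transfer operator of T_{23,23,23} maps the Banach space W = {f continuous on Δ : sup_Δ |x f(x,y)| < ∞} into itself. -/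
/-- The open triangle `Δ = {(x,y) : 0 < y < x < 1}`. -/
def triangleΔ : Set (ℝ × ℝ) := {p | 0 < p.2 ∧ p.2 < p.1 ∧ p.1 < 1}

lemma one_lt_denom {p : ℝ × ℝ} (hp : p ∈ triangleΔ) (k : ℕ) :
    1 < ((k : ℝ) + 1) * p.1 - p.2 + 1 := by
  obtain ⟨h0, h1, h2⟩ := hp
  have : 0 ≤ (k : ℝ) * p.1 := mul_nonneg k.cast_nonneg (h0.trans h1).le
  nlinarith

lemma inverseBranch_mem {p : ℝ × ℝ} (hp : p ∈ triangleΔ) (k : ℕ) :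
    ((1 : ℝ) / (((k : ℝ) + 1) * p.1 - p.2 + 1),
      (1 - p.1) / (((k : ℝ) + 1) * p.1 - p.2 + 1)) ∈ triangleΔ := by
  have hD := one_lt_denom hp k
  have hD0 := zero_lt_one.trans hD
  obtain ⟨h0, h1, h2⟩ := hp
  refine ⟨div_pos (by linarith) hD0, ?_, ?_⟩
  · exact div_lt_div_of_pos_right (by linarith) hD0
  · exact (div_lt_one hD0).2 hD

lemma sum_range_div_sq_le {a c : ℝ} (ha : 1 ≤ a) (hc : 0 < c) (hc1 : c ≤ 1) (n : ℕ) :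
    ∑ k ∈ Finset.range n, c * (1 / (a + k * c) ^ 2) ≤ 2 := by
  have hpos : ∀ k : ℕ, 1 ≤ a + k * c := fun k => by
    have : 0 ≤ (k : ℝ) * c := by positivity
    linarith
  have key : ∀ k ∈ Finset.range n, c * (1 / (a + k * c) ^ 2) ≤
      2 * (1 / (a + k * c) - 1 / (a + ((k + 1 : ℕ) : ℝ) * c)) := fun k _ => by
    have h := hpos k
    have hs : a + ((k + 1 : ℕ) : ℝ) * c = (a + k * c) + c := by push_cast; ring
    rw [hs]
    generalize a + k * c = D at h
    have hD : 0 < D := by linarith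
    have hDc : 0 < D + c := by linarith
    have : 2 * (1 / D - 1 / (D + c)) - c * (1 / D ^ 2) = c * (D - c) / (D ^ 2 * (D + c)) := by
      field_simp
      ring
    have : 0 ≤ c * (D - c) / (D ^ 2 * (D + c)) :=
      div_nonneg (mul_nonneg hc.le (by linarith)) (by positivity)
    linarith
  refine (Finset.sum_le_sum key).trans ?_
  rw [← Finset.mul_sum, Finset.sum_range_sub' (fun k : ℕ => 1 / (a + (k : ℝ) * c))]
  have h1 : 1 / (a + ((0 : ℕ) : ℝ) * c) ≤ 1 := by
    rw [div_le_one (by linarith [hpos 0])]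
    exact hpos 0
  have h2 : 0 ≤ 1 / (a + (n : ℝ) * c) := by
    have := hpos n
    positivity
  linarith

lemma summable_mul_div_sq {a c : ℝ} (ha : 1 ≤ a) (hc : 0 < c) (hc1 : c ≤ 1) :
    Summable fun k : ℕ => c * (1 / (a + k * c) ^ 2) :=
  summable_of_sum_range_le (fun _ => by positivity) (sum_range_div_sq_le ha hc hc1)

lemma tsum_mul_div_sq_le {a c : ℝ} (ha : 1 ≤ a) (hc : 0 < c) (hc1 : c ≤ 1) :
    ∑' k : ℕ, c * (1 / (a + k * c) ^ 2) ≤ 2 :=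
  Real.tsum_le_of_sum_range_le (fun _ => by positivity) (sum_range_div_sq_le ha hc hc1)

lemma abs_transfer_term_le {f : ℝ × ℝ → ℝ} {M : ℝ}
    (hbd : ∀ p ∈ triangleΔ, |p.1 * f p| ≤ M) {p : ℝ × ℝ} (hp : p ∈ triangleΔ) (k : ℕ) :
    |(1 / (((k : ℝ) + 1) * p.1 - p.2 + 1) ^ 3) *
        f (1 / (((k : ℝ) + 1) * p.1 - p.2 + 1),
           (1 - p.1) / (((k : ℝ) + 1) * p.1 - p.2 + 1))| ≤
      M * (1 / (((k : ℝ) + 1) * p.1 - p.2 + 1) ^ 2) := by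
  have hD := zero_lt_one.trans (one_lt_denom hp k)
  have hb := hbd _ (inverseBranch_mem hp k)
  dsimp only at hb
  generalize f _ = v at hb ⊢
  generalize ((k : ℝ) + 1) * p.1 - p.2 + 1 = D at hD hb ⊢
  have : 1 / D ^ 3 * v = (1 / D * v) * (1 / D ^ 2) := by
    field_simp
  rw [this, abs_mul, abs_of_pos (a := 1 / D ^ 2) (by positivity)]
  gcongr

lemma abs_transfer_term_le_of_le {f : ℝ × ℝ → ℝ} {M : ℝ} (hM : 0 ≤ M)
    (hbd : ∀ p ∈ triangleΔ, |p.1 * f p| ≤ M) {p : ℝ × ℝ} (hp : p ∈ triangleΔ)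
    {c : ℝ} (hc : 0 < c) (hcp : c ≤ p.1) (k : ℕ) :
    |(1 / (((k : ℝ) + 1) * p.1 - p.2 + 1) ^ 3) *
        f (1 / (((k : ℝ) + 1) * p.1 - p.2 + 1),
           (1 - p.1) / (((k : ℝ) + 1) * p.1 - p.2 + 1))| ≤
      M / c * (c * (1 / (1 + k * c) ^ 2)) := by
  refine (abs_transfer_term_le hbd hp k).trans ?_
  rw [← mul_assoc, div_mul_cancel₀ _ hc.ne']
  have h : 1 + k * c ≤ ((k : ℝ) + 1) * p.1 - p.2 + 1 := by
    have := mul_le_mul_of_nonneg_left hcp (k.cast_nonneg (α := ℝ))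
    linarith [hp.2.1]
  gcongr

/-- The transfer operator of `T_{23,23,23}` maps the Banach space
`W = {f continuous on Δ : sup_Δ |x f(x,y)| < ∞}` into itself: if `f` is continuous on `Δ`
with `|x·f(x,y)| ≤ M` on `Δ`, then (i) all points where `f` is evaluated lie in `Δ`,
(ii) the defining series converges absolutely, (iii) `Lf` is continuous on `Δ`, and
(iv) `|x·(Lf)(x,y)| ≤ 2M` on `Δ`. -/
theorem trip_232323_transfer_maps_W (f : ℝ × ℝ → ℝ) (hf : ContinuousOn f triangleΔ)
    (M : ℝ) (hM : 0 ≤ M) (hbd : ∀ p ∈ triangleΔ, |p.1 * f p| ≤ M) :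
    (∀ p ∈ triangleΔ, ∀ k : ℕ,
      ((1 : ℝ) / (((k : ℝ) + 1) * p.1 - p.2 + 1),
        (1 - p.1) / (((k : ℝ) + 1) * p.1 - p.2 + 1)) ∈ triangleΔ) ∧
    (∀ p ∈ triangleΔ, Summable (fun k : ℕ =>
      |(1 / (((k : ℝ) + 1) * p.1 - p.2 + 1) ^ 3) *
        f (1 / (((k : ℝ) + 1) * p.1 - p.2 + 1),
           (1 - p.1) / (((k : ℝ) + 1) * p.1 - p.2 + 1))|)) ∧
    ContinuousOn (fun p : ℝ × ℝ => ∑' k : ℕ,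
      (1 / (((k : ℝ) + 1) * p.1 - p.2 + 1) ^ 3) *
        f (1 / (((k : ℝ) + 1) * p.1 - p.2 + 1),
           (1 - p.1) / (((k : ℝ) + 1) * p.1 - p.2 + 1))) triangleΔ ∧
    (∀ p ∈ triangleΔ,
      |p.1 * ∑' k : ℕ, (1 / (((k : ℝ) + 1) * p.1 - p.2 + 1) ^ 3) *
        f (1 / (((k : ℝ) + 1) * p.1 - p.2 + 1),
           (1 - p.1) / (((k : ℝ) + 1) * p.1 - p.2 + 1))| ≤ 2 * M) := by
  have hsum : ∀ p ∈ triangleΔ, Summable (fun k : ℕ =>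
      |(1 / (((k : ℝ) + 1) * p.1 - p.2 + 1) ^ 3) *
        f (1 / (((k : ℝ) + 1) * p.1 - p.2 + 1),
           (1 - p.1) / (((k : ℝ) + 1) * p.1 - p.2 + 1))|) := fun p hp => by
    have hx : 0 < p.1 := hp.1.trans hp.2.1
    exact ((summable_mul_div_sq le_rfl hx hp.2.2.le).mul_left (M / p.1)).of_nonneg_of_le
      (fun _ => abs_nonneg _) (abs_transfer_term_le_of_le hM hbd hp hx le_rfl)
  refine ⟨fun p hp k => inverseBranch_mem hp k, hsum, ?_, fun p hp => ?_⟩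
  · refine continuousOn_of_locally_continuousOn fun q hq => ?_
    have hq0 : 0 < q.1 := hq.1.trans hq.2.1
    have hc : 0 < q.1 / 2 := by linarith
    refine ⟨{p | q.1 / 2 < p.1}, isOpen_lt continuous_const continuous_fst,
      half_lt_self hq0, ?_⟩
    refine continuousOn_tsum (fun k => ?_)
      ((summable_mul_div_sq le_rfl hc (by linarith [hq.2.2])).mul_left (M / (q.1 / 2)))
      fun k p hp => abs_transfer_term_le_of_le hM hbd hp.1 hc (le_of_lt hp.2) k
    refine ContinuousOn.mono ?_ Set.inter_subset_left
    have hD : ∀ p ∈ triangleΔ, ((k : ℝ) + 1) * p.1 - p.2 + 1 ≠ 0 := fun p hp =>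
      (zero_lt_one.trans (one_lt_denom hp k)).ne'
    have hDc : ContinuousOn (fun p : ℝ × ℝ => ((k : ℝ) + 1) * p.1 - p.2 + 1) triangleΔ := by
      fun_prop
    refine (continuousOn_const.div (hDc.pow 3) fun p hp => pow_ne_zero 3 (hD p hp)).mul
      (hf.comp ((continuousOn_const.div hDc hD).prodMk (ContinuousOn.div ?_ hDc hD))
        fun p hp => inverseBranch_mem hp k)
    fun_prop
  · have hx : 0 < p.1 := hp.1.trans hp.2.1
    have ha : 1 ≤ 1 + p.1 - p.2 := by linarith [hp.2.1]
    rw [← tsum_mul_left, ← Real.norm_eq_abs, mul_comm 2 M]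
    have hS := summable_mul_div_sq ha hx hp.2.2.le
    refine (tsum_of_norm_bounded (hS.mul_left M).hasSum fun k => ?_).trans ?_
    · rw [Real.norm_eq_abs, abs_mul, abs_of_pos hx]
      calc _ ≤ p.1 * (M * (1 / (((k : ℝ) + 1) * p.1 - p.2 + 1) ^ 2)) :=
            mul_le_mul_of_nonneg_left (abs_transfer_term_le hbd hp k) hx.le
        _ = _ := by
          rw [show ((k : ℝ) + 1) * p.1 - p.2 + 1 = 1 + p.1 - p.2 + k * p.1 by ring]
          ring
    · rw [tsum_mul_left]
      exact mul_le_mul_of_nonneg_left (tsum_mul_div_sq_le ha hx hp.2.2.le) hM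
end

section
/- The function 6/(π² x (1−y)) is a probability density on the open triangle Δ: ∫_0^1 ( ∫_0^x 6/(π² · x · (1−y)) dy ) dx = 1. -/
open MeasureTheory in
/-- The dilogarithm value `Li₂(1) = π² / 6` as an integral. -/
theorem integral_neg_log_one_sub_div :
    ∫ x in (0 : ℝ)..1, -Real.log (1 - x) / x = Real.pi ^ 2 / 6 := by
  have hpow (n : ℕ) : ∫ x in Set.Ioo (0 : ℝ) 1, x ^ n / ((n : ℝ) + 1) = 1 / ((n : ℝ) + 1) ^ 2 := by
    rw [← integral_Ioc_eq_integral_Ioo, ← intervalIntegral.integral_of_le zero_le_one,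
      intervalIntegral.integral_div, integral_pow]
    simp only [one_pow, ne_eq, Nat.add_eq_zero_iff, one_ne_zero, and_false, not_false_eq_true,
      zero_pow, sub_zero]
    field_simp
  have hnorm (n : ℕ) :
      ∫ x in Set.Ioo (0 : ℝ) 1, ‖x ^ n / ((n : ℝ) + 1)‖ = 1 / ((n : ℝ) + 1) ^ 2 := by
    rw [← hpow n]
    refine setIntegral_congr_fun measurableSet_Ioo fun x hx => ?_
    have := hx.1
    exact Real.norm_of_nonneg (by positivity)
  have hint (n : ℕ) : IntegrableOn (fun x : ℝ => x ^ n / ((n : ℝ) + 1)) (Set.Ioo 0 1) :=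
    (Continuous.integrableOn_Icc (by fun_prop)).mono_set Set.Ioo_subset_Icc_self
  have hzeta : HasSum (fun n : ℕ => 1 / ((n : ℝ) + 1) ^ 2) (Real.pi ^ 2 / 6) := by
    simpa using (hasSum_nat_add_iff' 1).mpr hasSum_zeta_two
  have hsum := hasSum_integral_of_summable_integral_norm hint
    (by simpa only [hnorm] using hzeta.summable)
  simp only [hpow] at hsum
  rw [intervalIntegral.integral_of_le zero_le_one, integral_Ioc_eq_integral_Ioo,
    ← hsum.unique hzeta]
  refine setIntegral_congr_fun measurableSet_Ioo fun x hx => ?_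
  have hx0 : x ≠ 0 := hx.1.ne'
  have hlog := (Real.hasSum_pow_div_log_of_abs_lt_one
    (abs_lt.mpr ⟨by linarith [hx.1], hx.2⟩)).div_const x
  refine hlog.tsum_eq.symm.trans (tsum_congr fun n => ?_)
  rw [pow_succ]
  field_simp

/-- The primitive of `1 / (1 - y)` vanishing at `0`, for `x < 1`. -/
theorem integral_inv_one_sub {x : ℝ} (hx : x < 1) :
    ∫ y in (0 : ℝ)..x, (1 - y)⁻¹ = -Real.log (1 - x) := by
  rw [intervalIntegral.integral_comp_sub_left (fun y => y⁻¹) 1, sub_zero,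
    integral_inv_of_pos (sub_pos.mpr hx) one_pos, one_div, Real.log_inv]

/-- The invariant density `6/(π² x (1−y))` of the triangle partition map `T_{e,23,e}`
is a probability density on the open triangle `Δ = {0 < y < x < 1}`. -/
theorem trip_e23e_density_integral_one :
    (∫ x in (0 : ℝ)..1, ∫ y in (0 : ℝ)..x, 6 / (Real.pi ^ 2 * x * (1 - y))) = 1 := by
  have hinner : ∀ x ∈ Set.Ioo (0 : ℝ) 1, ∫ y in (0 : ℝ)..x, 6 / (Real.pi ^ 2 * x * (1 - y)) =
      6 / Real.pi ^ 2 * (-Real.log (1 - x) / x) := by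
    intro x hx
    simp_rw [← div_div _ _ (1 - _ : ℝ), div_eq_mul_inv _ (1 - _ : ℝ)]
    rw [intervalIntegral.integral_const_mul, integral_inv_one_sub hx.2]
    ring
  calc _ = ∫ x in (0 : ℝ)..1, 6 / Real.pi ^ 2 * (-Real.log (1 - x) / x) := by
        simp only [intervalIntegral.integral_of_le zero_le_one,
          MeasureTheory.integral_Ioc_eq_integral_Ioo]
        exact MeasureTheory.setIntegral_congr_fun measurableSet_Ioo hinner
    _ = 1 := by
        rw [intervalIntegral.integral_const_mul, integral_neg_log_one_sub_div]
        field_simp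
end
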